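/- For any k-rectangle □ and any k-bounded partitions λ and μ: λ ≼ μ in the k-Young order if and only if (λ ∪ □) ≼ (μ ∪ □) in the k-Young order. -/

import Mathlib

/-- A partition: a weakly decreasing list of positive integers. -/
def IsPartition (l : List ℕ) : Prop :=
  l.Pairwise (· ≥ ·) ∧ ∀ x ∈ l, 0 < x

/-- The `i`-th part (0-indexed), with parts beyond the length equal to 0. -/
def part (l : List ℕ) (i : ℕ) : ℕ := l.getD i 0

/-- Diagram containment `l ⊆ m`: every part of `l` is at most the corresponding part of `m`. -/
def SubDiag (l m : List ℕ) : Prop := ∀ i, part l i ≤ part m i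

/-- A `k`-bounded partition: a partition whose first part is at most `k`. -/
def KBounded (k : ℕ) (l : List ℕ) : Prop := IsPartition l ∧ part l 0 ≤ k

/-- Hook length of the square `(i,j)` (0-indexed) with respect to the skew diagram
`outer/inner`: the number of cells `(i,j')` of the skew diagram with `j' ≥ j` plus the
number of cells `(i',j)` of the skew diagram with `i' > i`. -/
def hookLen (outer inner : List ℕ) (i j : ℕ) : ℕ :=
  ((Finset.range (part outer i)).filter (fun j' => j ≤ j' ∧ part inner i ≤ j')).card +
  ((Finset.range outer.length).filter
    (fun i' => i < i' ∧ part inner i' ≤ j ∧ j < part outer i')).card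

/-- `(outer, inner)` is the `k`-skew diagram of the `k`-bounded partition `l`:
row `i` of `outer/inner` has `l i` cells, every cell of `outer/inner` has hook length
at most `k`, and every square of the inner shape has hook length exceeding `k`. -/
def IsKSkew (k : ℕ) (l outer inner : List ℕ) : Prop :=
  IsPartition outer ∧ IsPartition inner ∧ SubDiag inner outer ∧
  (∀ i, part outer i - part inner i = part l i) ∧
  (∀ i j, part inner i ≤ j → j < part outer i → hookLen outer inner i j ≤ k) ∧
  (∀ i j, j < part inner i → k < hookLen outer inner i j)

/-- Length of column `j` of the skew diagram `outer/inner`. -/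
def colLen (outer inner : List ℕ) (j : ℕ) : ℕ :=
  ((Finset.range outer.length).filter
    (fun i => part inner i ≤ j ∧ j < part outer i)).card

/-- The list of column lengths of the skew diagram `outer/inner`. -/
def skewCols (outer inner : List ℕ) : List ℕ :=
  ((List.range (part outer 0)).map (colLen outer inner)).filter (fun x => decide (x ≠ 0))

/-- The `k`-conjugate of `l`: the partition whose parts are the column lengths of the
(unique) `k`-skew diagram of `l`. -/
noncomputable def kConj (k : ℕ) (l : List ℕ) : List ℕ :=
  haveI := Classical.dec (∃ p : List ℕ × List ℕ, IsKSkew k l p.1 p.2)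
  if h : ∃ p : List ℕ × List ℕ, IsKSkew k l p.1 p.2 then
    skewCols h.choose.1 h.choose.2
  else []

/-- The covering relation of the `k`-Young order on `k`-bounded partitions. -/
def KCover (k : ℕ) (l m : List ℕ) : Prop :=
  KBounded k l ∧ KBounded k m ∧ SubDiag l m ∧
  SubDiag (kConj k l) (kConj k m) ∧ m.sum = l.sum + 1

/-- The `k`-Young order: reflexive-transitive closure of the covering relation. -/
def KLe (k : ℕ) : List ℕ → List ℕ → Prop := Relation.ReflTransGen (KCover k)

/-- The weakly decreasing rearrangement of the combined parts of two partitions. -/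
def punion (l r : List ℕ) : List ℕ := (l ++ r).mergeSort (fun a b => decide (a ≥ b))

/-- The ordinary conjugate of a partition: the list of column lengths of its diagram. -/
def conj (l : List ℕ) : List ℕ :=
  (List.range (part l 0)).map (fun j => (l.filter (fun x => decide (j < x))).length)

/-! ### Partitions as lists -/

@[simp] theorem part_nil (i : ℕ) : part [] i = 0 := by simp [part]

@[simp] theorem part_cons_zero (x : ℕ) (l : List ℕ) : part (x :: l) 0 = x := by simp [part]

@[simp] theorem part_cons_succ (x : ℕ) (l : List ℕ) (i : ℕ) :
    part (x :: l) (i + 1) = part l i := by simp [part]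

theorem IsPartition.tail {x : ℕ} {l : List ℕ} (h : IsPartition (x :: l)) : IsPartition l :=
  ⟨(List.pairwise_cons.1 h.1).2, fun y hy => h.2 y (List.mem_cons_of_mem _ hy)⟩

theorem IsPartition.sublist {l m : List ℕ} (h : IsPartition m) (hs : List.Sublist l m) :
    IsPartition l :=
  ⟨h.1.sublist hs, fun x hx => h.2 x (hs.subset hx)⟩

theorem IsPartition.eq_of_perm {l m : List ℕ} (hl : IsPartition l) (hm : IsPartition m)
    (h : l.Perm m) : l = m :=
  h.eq_of_pairwise (fun _ _ _ _ hab hba => le_antisymm hba hab) hl.1 hm.1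

theorem part_eq_zero_of_length_le {l : List ℕ} {i : ℕ} (h : l.length ≤ i) : part l i = 0 := by
  simp [part, List.getElem?_eq_none h]

theorem part_eq_getElem {l : List ℕ} {i : ℕ} (h : i < l.length) : part l i = l[i] := by
  simp [part, h]

theorem IsPartition.lt_part_iff {l : List ℕ} (h : IsPartition l) (i v : ℕ) :
    v < part l i ↔ i < l.countP (fun x => decide (v < x)) := by
  induction l generalizing i with
  | nil => simp
  | cons x l ih =>
    have hx := (List.pairwise_cons.1 h.1).1
    by_cases hv : v < x
    · cases i with
      | zero => simp [hv]
      | succ i => simp [hv, ih h.tail]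
    · have h0 : l.countP (fun x => decide (v < x)) = 0 := by
        rw [List.countP_eq_zero]
        intro y hy
        have := hx y hy
        simp only [decide_eq_true_eq]
        omega
      cases i with
      | zero => simp [hv, h0]
      | succ i => simp [hv, h0, ih h.tail]

/-- Containment of partitions is containment of their conjugates. -/
theorem subDiag_iff_countP {l m : List ℕ} (hl : IsPartition l) (hm : IsPartition m) :
    SubDiag l m ↔
      ∀ v, l.countP (fun x => decide (v < x)) ≤ m.countP (fun x => decide (v < x)) := by
  constructor
  · intro h v
    by_contra! hlt
    have h1 := (hl.lt_part_iff _ v).2 hlt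
    have h2 := (hm.lt_part_iff (m.countP (fun x => decide (v < x))) v).not.2 (lt_irrefl _)
    have := h (m.countP (fun x => decide (v < x)))
    omega
  · intro h i
    by_contra! hlt
    have h1 := (hl.lt_part_iff i _).1 hlt
    have h2 := (hm.lt_part_iff i (part m i)).not.1 (lt_irrefl _)
    have := h (part m i)
    omega

theorem SubDiag.tail {x y : ℕ} {l m : List ℕ} (h : SubDiag (x :: l) (y :: m)) :
    SubDiag l m := fun i => by simpa using h (i + 1)

theorem SubDiag.sum_le {l m : List ℕ} (h : SubDiag l m) : l.sum ≤ m.sum := by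
  induction l generalizing m with
  | nil => simp
  | cons x l ih =>
    cases m with
    | nil =>
      have h0 : x = 0 := by simpa using h 0
      have := ih (m := []) fun i => by simpa using h (i + 1)
      simpa [h0] using this
    | cons y m =>
      have := ih (SubDiag.tail h)
      have h0 : x ≤ y := by simpa using h 0
      simp only [List.sum_cons]
      omega

theorem SubDiag.eq_of_sum_eq {l m : List ℕ} (h : SubDiag l m) (hl : ∀ x ∈ l, 0 < x)
    (hm : ∀ x ∈ m, 0 < x) (hs : m.sum = l.sum) : l = m := by
  induction l generalizing m with
  | nil =>
    cases m with
    | nil => rfl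
    | cons y m =>
      have := hm y (by simp)
      simp at hs
      omega
  | cons x l ih =>
    cases m with
    | nil =>
      have := hl x (by simp)
      simp at hs
      omega
    | cons y m =>
      have hsum := (SubDiag.tail h).sum_le
      have h0 : x ≤ y := by simpa using h 0
      simp only [List.sum_cons] at hs
      have hxy : x = y := by omega
      rw [hxy, ih (SubDiag.tail h) (fun z hz => hl z (by simp [hz]))
        (fun z hz => hm z (by simp [hz])) (by omega)]

theorem SubDiag.add_one_cases {l m : List ℕ} (h : SubDiag l m) (hl : ∀ x ∈ l, 0 < x)
    (hm : ∀ x ∈ m, 0 < x) (hs : m.sum = l.sum + 1) :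
    m = l ++ [1] ∨ ∃ a r b, l = a ++ r :: b ∧ m = a ++ (r + 1) :: b := by
  induction l generalizing m with
  | nil =>
    left
    cases m with
    | nil => simp at hs
    | cons y m =>
      have := hm y (by simp)
      simp only [List.sum_cons, List.sum_nil] at hs
      have h1 : y = 1 := by omega
      have h2 : ([] : List ℕ) = m := SubDiag.eq_of_sum_eq (fun i => by simp) (by simp)
        (fun z hz => hm z (by simp [hz])) (by simp; omega)
      simp [h1, ← h2]
  | cons x l ih =>
    cases m with
    | nil => simp at hs
    | cons y m =>
      have hsum := (SubDiag.tail h).sum_le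
      have h0 : x ≤ y := by simpa using h 0
      have hl' : ∀ z ∈ l, 0 < z := fun z hz => hl z (by simp [hz])
      have hm' : ∀ z ∈ m, 0 < z := fun z hz => hm z (by simp [hz])
      simp only [List.sum_cons] at hs
      rcases h0.eq_or_lt with rfl | hlt
      · rcases ih (SubDiag.tail h) hl' hm' (by omega) with rfl | ⟨a, r, b, rfl, rfl⟩
        · exact Or.inl rfl
        · exact Or.inr ⟨x :: a, r, b, rfl, rfl⟩
      · obtain rfl : y = x + 1 := by omega
        obtain rfl := (SubDiag.tail h).eq_of_sum_eq hl' hm' (by omega)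
        exact Or.inr ⟨[], x, l, rfl, rfl⟩

/-- Values of an antitone function on an initial segment, with the trailing zeros removed. -/
theorem part_filter_map_range {f : ℕ → ℕ} (hf : Antitone f) {n : ℕ} (hn : ∀ j, n ≤ j → f j = 0)
    (j : ℕ) : part (((List.range n).map f).filter (fun x => decide (x ≠ 0))) j = f j := by
  induction n generalizing f j with
  | zero => simp [hn]
  | succ n ih =>
    rw [List.range_succ_eq_map, List.map_cons, List.map_map]
    have hf' : Antitone (f ∘ Nat.succ) := fun a b hab => hf (Nat.succ_le_succ hab)
    have hn' : ∀ j, n ≤ j → (f ∘ Nat.succ) j = 0 := fun j hj => hn _ (Nat.succ_le_succ hj)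
    by_cases h0 : f 0 = 0
    · have hz : ∀ j, f j = 0 := fun j => Nat.le_zero.1 (h0 ▸ hf (Nat.zero_le j))
      rw [List.filter_cons_of_neg (by simp [h0]), ih hf' hn']
      simp [hz]
    · rw [List.filter_cons_of_pos (by simp [h0])]
      cases j with
      | zero => simp
      | succ j => rw [part_cons_succ, ih hf' hn']; rfl

theorem isPartition_filter_map_range {f : ℕ → ℕ} (hf : Antitone f) (n : ℕ) :
    IsPartition (((List.range n).map f).filter (fun x => decide (x ≠ 0))) := by
  refine ⟨List.Pairwise.filter _ ?_, fun x hx => ?_⟩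
  · rw [List.pairwise_map]
    exact List.pairwise_lt_range.imp fun hab => hf hab.le
  · have := (List.mem_filter.1 hx).2
    simp only [decide_eq_true_eq] at this
    omega

theorem KBounded.le {k : ℕ} {l : List ℕ} (h : KBounded k l) : ∀ x ∈ l, x ≤ k := by
  rcases h with ⟨⟨hp, -⟩, h0⟩
  cases l with
  | nil => simp
  | cons y l =>
    intro x hx
    simp only [part_cons_zero] at h0
    rcases List.mem_cons.1 hx with rfl | hx
    · exact h0
    · exact ((List.pairwise_cons.1 hp).1 x hx).trans h0

theorem kBounded_iff {k : ℕ} {l : List ℕ} :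
    KBounded k l ↔ IsPartition l ∧ ∀ x ∈ l, x ≤ k := by
  refine ⟨fun h => ⟨h.1, h.le⟩, fun h => ⟨h.1, ?_⟩⟩
  cases l with
  | nil => simp
  | cons y l => simpa using h.2 y (by simp)

/-! ### The column counts of the `k`-skew diagram -/

/-- The effect on the function `v ↦ #{columns of length > v}` of adding a row of length `r` at the
bottom of a `k`-skew diagram. -/
def rowStep (k r : ℕ) (N : ℕ → ℕ) (v : ℕ) : ℕ :=
  if v = 0 then N (k - r) + r else if v ≤ k - r then N (v - 1) else N v

/-- `colCount k l v` is the number of columns of length greater than `v` in the `k`-skew diagram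
of `l`; see `IsKSkew.lt_colLen_iff`. -/
def colCount (k : ℕ) : List ℕ → ℕ → ℕ
  | [] => fun _ => 0
  | r :: l => rowStep k r (colCount k l)

theorem le_rowStep {k r : ℕ} {N : ℕ → ℕ} (hN : Antitone N) (h : N 0 ≤ N (k - r) + r) (v : ℕ) :
    N v ≤ rowStep k r N v := by
  unfold rowStep
  split_ifs with h1 h2
  · simpa [h1] using h
  · exact hN (Nat.sub_le _ _)
  · exact le_rfl

theorem antitone_rowStep {k r : ℕ} {N : ℕ → ℕ} (hN : Antitone N) (h : N 0 ≤ N (k - r) + r) :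
    Antitone (rowStep k r N) := by
  refine antitone_nat_of_succ_le fun v => ?_
  simp only [rowStep, Nat.succ_ne_zero, if_false, Nat.add_sub_cancel]
  rcases Nat.eq_zero_or_pos v with rfl | hv
  · have := hN (Nat.zero_le 1)
    simp only [if_true]
    split_ifs <;> simp only [zero_add] at * <;> omega
  · have h1 := hN (Nat.sub_le v 1)
    have h2 := hN (Nat.le_succ v)
    simp only [Nat.succ_eq_add_one] at h2
    split_ifs <;> omega

theorem antitone_colCount_and_le {k : ℕ} {l : List ℕ} (h : l.Pairwise (· ≥ ·)) :
    Antitone (colCount k l) ∧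
      ∀ s, (∀ x ∈ l, x ≤ s) → colCount k l 0 ≤ colCount k l (k - s) + s := by
  induction l with
  | nil => exact ⟨fun _ _ _ => le_rfl, fun s _ => Nat.zero_le _⟩
  | cons r l ih =>
    obtain ⟨hr, hl⟩ := List.pairwise_cons.1 h
    obtain ⟨hN, hle⟩ := ih hl
    have hN' := antitone_rowStep hN (hle r hr)
    refine ⟨hN', fun s hs => ?_⟩
    have hrs : r ≤ s := hs r (by simp)
    have h1 := le_rowStep hN (hle r hr) (k - r)
    have h2 : rowStep k r (colCount k l) (k - r) ≤ rowStep k r (colCount k l) (k - s) :=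
      hN' (by omega)
    have h3 : rowStep k r (colCount k l) 0 = colCount k l (k - r) + r := by simp [rowStep]
    simp only [colCount]
    omega

theorem antitone_colCount {k : ℕ} {l : List ℕ} (h : l.Pairwise (· ≥ ·)) :
    Antitone (colCount k l) := (antitone_colCount_and_le h).1

theorem colCount_zero_le {k s : ℕ} {l : List ℕ} (h : l.Pairwise (· ≥ ·)) (hs : ∀ x ∈ l, x ≤ s) :
    colCount k l 0 ≤ colCount k l (k - s) + s := (antitone_colCount_and_le h).2 s hs

theorem rowStep_iterate {k r : ℕ} (N : ℕ → ℕ) {t : ℕ} (ht : t ≤ k - r + 1) (v : ℕ) :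
    (rowStep k r)^[t] N v =
      if v ≤ k - r then (if v < t then N (v + (k - r + 1) - t) + r else N (v - t)) else N v := by
  induction t generalizing v with
  | zero => simp
  | succ t ih =>
    rw [Function.iterate_succ_apply', rowStep, ih (by omega), ih (by omega), ih (by omega)]
    rcases Nat.eq_zero_or_pos v with rfl | hv
    · simp only [↓reduceIte, le_refl, Nat.zero_le, Nat.zero_lt_succ]
      rw [if_neg (by omega)]
      congr 2
      omega
    · rw [if_neg (by omega)]
      by_cases hvk : v ≤ k - r
      · simp only [hvk, if_true]
        rw [if_pos (by omega)]
        by_cases hvt : v - 1 < t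
        · rw [if_pos hvt, if_pos (by omega)]
          congr 2
          omega
        · rw [if_neg hvt, if_neg (by omega)]
          congr 1
          omega
      · simp only [hvk, if_false]

theorem colCount_append (k : ℕ) (a b : List ℕ) :
    colCount k (a ++ b) = a.foldr (rowStep k) (colCount k b) := by
  induction a with
  | nil => rfl
  | cons x a ih => simp [colCount, ih]

theorem colCount_replicate_append (k r t : ℕ) (b : List ℕ) :
    colCount k (List.replicate t r ++ b) = (rowStep k r)^[t] (colCount k b) := by
  induction t with
  | zero => rfl
  | succ t ih => rw [List.replicate_succ, List.cons_append, colCount, ih,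
      Function.iterate_succ_apply']

theorem foldr_rowStep_add {k ℓ : ℕ} {N M : ℕ → ℕ}
    (h : ∀ v, M v = N v + if v ≤ k - ℓ then ℓ else 0) {a : List ℕ} (ha : ∀ x ∈ a, ℓ ≤ x) (v : ℕ) :
    a.foldr (rowStep k) M v = a.foldr (rowStep k) N v + if v ≤ k - ℓ then ℓ else 0 := by
  induction a generalizing v with
  | nil => exact h v
  | cons x a ih =>
    have hx : ℓ ≤ x := ha x (by simp)
    have ih' := ih fun y hy => ha y (by simp [hy])
    simp only [List.foldr_cons, rowStep, ih']
    split_ifs <;> omega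

theorem foldr_rowStep_of_lt {k v : ℕ} (N : ℕ → ℕ) {a : List ℕ} (hv : v ≠ 0)
    (ha : ∀ x ∈ a, k - x < v) : a.foldr (rowStep k) N v = N v := by
  induction a with
  | nil => rfl
  | cons x a ih =>
    have hx : k - x < v := ha x (by simp)
    rw [List.foldr_cons, rowStep, if_neg hv, if_neg (by omega),
      ih fun y hy => ha y (by simp [hy])]

/-! ### Existence and columns of `k`-skew diagrams -/

/-- Number of cells in column `j` in rows at least `i`. -/
def colLenFrom (outer inner : List ℕ) (i j : ℕ) : ℕ :=
  ((Finset.range outer.length).filter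
    (fun i' => i ≤ i' ∧ part inner i' ≤ j ∧ j < part outer i')).card

theorem colLenFrom_eq_succ {outer inner : List ℕ} {i : ℕ} (hi : i < outer.length) (j : ℕ) :
    colLenFrom outer inner i j = colLenFrom outer inner (i + 1) j +
      if part inner i ≤ j ∧ j < part outer i then 1 else 0 := by
  unfold colLenFrom
  split_ifs with h
  · rw [← Finset.card_insert_of_notMem (a := i) (by simp)]
    congr 1
    ext x
    simp only [Finset.mem_filter, Finset.mem_range, Finset.mem_insert]
    constructor
    · rintro ⟨h1, h2, h3⟩
      rcases h2.eq_or_lt with rfl | h2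
      · exact Or.inl rfl
      · exact Or.inr ⟨h1, h2, h3⟩
    · rintro (rfl | ⟨h1, h2, h3⟩)
      · exact ⟨hi, le_rfl, h⟩
      · exact ⟨h1, by omega, h3⟩
  · rw [add_zero]
    congr 1
    ext x
    simp only [Finset.mem_filter, Finset.mem_range]
    constructor
    · rintro ⟨h1, h2, h3⟩
      rcases h2.eq_or_lt with rfl | h2
      · exact absurd h3 h
      · exact ⟨h1, h2, h3⟩
    · rintro ⟨h1, h2, h3⟩
      exact ⟨h1, by omega, h3⟩

theorem hookLen_eq (outer inner : List ℕ) (i j : ℕ) :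
    hookLen outer inner i j =
      (part outer i - max j (part inner i)) + colLenFrom outer inner (i + 1) j := by
  unfold hookLen colLenFrom
  congr 1
  rw [← Nat.card_Ico]
  congr 1
  ext x
  simp only [Finset.mem_filter, Finset.mem_range, Finset.mem_Ico, max_le_iff]
  tauto

theorem lt_colLenFrom_of_step {k i r : ℕ} {outer inner : List ℕ} {N : ℕ → ℕ}
    (hi : i < outer.length) (hN : Antitone N) (h0 : N 0 ≤ N (k - r) + r) (hr : 0 < r)
    (hrow : part inner i = N (k - r) ∧ part outer i = N (k - r) + r)
    (hnext : ∀ j v, v < colLenFrom outer inner (i + 1) j ↔ j < N v) (j v : ℕ) :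
    v < colLenFrom outer inner i j ↔ j < rowStep k r N v := by
  rw [colLenFrom_eq_succ hi, hrow.1, hrow.2, rowStep]
  have hv := hnext j v
  have hv1 := hnext j (v - 1)
  have hd := hnext j (k - r)
  have hz := hnext j 0
  have m0 := hN (Nat.zero_le (k - r))
  have m1 := hN (Nat.sub_le v 1)
  have m2 := hN (Nat.zero_le (v - 1))
  split_ifs with h1 h2 h3 h4 h5
  · omega
  · have := hN (show v - 1 ≤ k - r by omega)
    omega
  · have := hN (show k - r ≤ v by omega)
    omega
  · omega
  · have := hN (show v - 1 ≤ k - r by omega)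
    omega
  · omega

/-- The rows of `outer/inner` start where the column counts of the rows above dictate. -/
theorem lt_colLenFrom_iff {k : ℕ} {l outer inner : List ℕ} (hl : IsPartition l)
    (hlen : outer.length = l.length)
    (hrow : ∀ i, i < l.length →
      (∀ j v, v < colLenFrom outer inner (i + 1) j ↔ j < colCount k (l.drop (i + 1)) v) →
      part inner i = colCount k (l.drop (i + 1)) (k - part l i) ∧
      part outer i = colCount k (l.drop (i + 1)) (k - part l i) + part l i)
    {i : ℕ} (hi : i ≤ l.length) :
    ∀ j v, v < colLenFrom outer inner i j ↔ j < colCount k (l.drop i) v := by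
  induction hi using Nat.decreasingInduction with
  | self =>
    intro j v
    have : colLenFrom outer inner l.length j = 0 := by
      rw [colLenFrom, Finset.card_eq_zero, Finset.filter_eq_empty_iff]
      intro x hx
      rw [Finset.mem_range] at hx
      omega
    simp [this, colCount]
  | of_succ i hi ih =>
    have hdrop : l.drop i = part l i :: l.drop (i + 1) := by
      rw [part_eq_getElem hi, List.drop_eq_getElem_cons hi]
    have hsub : IsPartition (part l i :: l.drop (i + 1)) :=
      hdrop ▸ hl.sublist (List.drop_sublist _ _)
    rw [hdrop]
    exact lt_colLenFrom_of_step (hlen ▸ hi) (antitone_colCount hsub.tail.1)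
      (colCount_zero_le hsub.tail.1 (List.pairwise_cons.1 hsub.1).1) (hsub.2 _ (by simp))
      (hrow i hi ih) ih

theorem IsKSkew.length_eq {k : ℕ} {l outer inner : List ℕ} (hl : IsPartition l)
    (h : IsKSkew k l outer inner) : outer.length = l.length := by
  obtain ⟨ho, -, hsub, hdiff, -, hin⟩ := h
  apply le_antisymm
  · by_contra! hlt
    have hpos : 0 < part outer (outer.length - 1) := by
      rw [part_eq_getElem (by omega)]
      exact ho.2 _ (List.getElem_mem _)
    have h1 := hdiff (outer.length - 1)
    rw [part_eq_zero_of_length_le (by omega : l.length ≤ outer.length - 1)] at h1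
    have h2 := hsub (outer.length - 1)
    have h3 := hin (outer.length - 1) 0 (by omega)
    have h4 : colLenFrom outer inner (outer.length - 1 + 1) 0 = 0 := by
      rw [colLenFrom, Finset.card_eq_zero, Finset.filter_eq_empty_iff]
      intro x hx
      rw [Finset.mem_range] at hx
      omega
    rw [hookLen_eq, h4] at h3
    omega
  · by_contra! hlt
    have h1 := hdiff outer.length
    rw [part_eq_zero_of_length_le le_rfl, part_eq_getElem hlt] at h1
    have := hl.2 _ (List.getElem_mem hlt)
    omega

theorem colLenFrom_zero (outer inner : List ℕ) (j : ℕ) :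
    colLenFrom outer inner 0 j = colLen outer inner j := by
  simp [colLenFrom, colLen]

theorem IsKSkew.lt_colLen_iff {k : ℕ} {l outer inner : List ℕ} (hl : KBounded k l)
    (h : IsKSkew k l outer inner) (j v : ℕ) :
    v < colLen outer inner j ↔ j < colCount k l v := by
  have hlen := h.length_eq hl.1
  rw [← colLenFrom_zero]
  refine lt_colLenFrom_iff hl.1 hlen (fun i hi hnext => ?_) (Nat.zero_le _) j v
  obtain ⟨-, -, hsub, hdiff, hout, hin⟩ := h
  have hpos : 0 < part l i := by
    rw [part_eq_getElem hi]
    exact hl.1.2 _ (List.getElem_mem hi)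
  have hk : part l i ≤ k := by
    rw [part_eq_getElem hi]
    exact hl.le _ (List.getElem_mem hi)
  have hs := hsub i
  have hd := hdiff i
  have hge : colCount k (l.drop (i + 1)) (k - part l i) ≤ part inner i := by
    have h1 := hout i (part inner i) le_rfl (by omega)
    rw [hookLen_eq, max_self] at h1
    have h2 := hnext (part inner i) (k - part l i)
    omega
  have hle : part inner i ≤ colCount k (l.drop (i + 1)) (k - part l i) := by
    by_contra! hlt
    have h1 := hin i _ hlt
    rw [hookLen_eq, max_eq_right hlt.le] at h1
    have h2 := hnext (colCount k (l.drop (i + 1)) (k - part l i)) (k - part l i)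
    omega
  omega

/-- The beginnings of the rows of the `k`-skew diagram of `l`. -/
def rowStart (k : ℕ) (l : List ℕ) (i : ℕ) : ℕ := colCount k (l.drop (i + 1)) (k - part l i)

theorem colCount_drop_succ_le {k : ℕ} {l : List ℕ} (hl : IsPartition l) (i v : ℕ) :
    colCount k (l.drop (i + 1)) v ≤ colCount k (l.drop i) v := by
  by_cases hi : i < l.length
  · have hp : IsPartition (l.drop i) := hl.sublist (List.drop_sublist _ _)
    rw [List.drop_eq_getElem_cons hi] at hp ⊢
    exact le_rowStep (antitone_colCount hp.tail.1)
      (colCount_zero_le hp.tail.1 (List.pairwise_cons.1 hp.1).1) v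
  · simp [List.drop_eq_nil_of_le (show l.length ≤ i + 1 by omega), colCount]

theorem part_succ_le {l : List ℕ} (hl : IsPartition l) (i : ℕ) : part l (i + 1) ≤ part l i := by
  by_cases hi : i + 1 < l.length
  · rw [part_eq_getElem hi, part_eq_getElem (by omega)]
    exact List.pairwise_iff_getElem.1 hl.1 _ _ _ _ (Nat.lt_succ_self i)
  · rw [part_eq_zero_of_length_le (by omega)]
    exact Nat.zero_le _

theorem antitone_rowStart {k : ℕ} {l : List ℕ} (hl : IsPartition l) :
    Antitone (rowStart k l) := by
  refine antitone_nat_of_succ_le fun i => ?_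
  refine (colCount_drop_succ_le hl (i + 1) _).trans ?_
  have := part_succ_le hl i
  exact antitone_colCount (hl.sublist (List.drop_sublist _ _)).1 (by omega)

theorem rowStart_eq_zero {k i : ℕ} {l : List ℕ} (hi : l.length ≤ i) : rowStart k l i = 0 := by
  simp [rowStart, List.drop_eq_nil_of_le (show l.length ≤ i + 1 by omega), colCount]

theorem exists_isKSkew {k : ℕ} {l : List ℕ} (hl : KBounded k l) :
    ∃ p : List ℕ × List ℕ, IsKSkew k l p.1 p.2 := by
  have hanti := antitone_rowStart (k := k) hl.1
  have hanti' : Antitone fun i => rowStart k l i + part l i :=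
    hanti.add (antitone_nat_of_succ_le (part_succ_le hl.1))
  have hzero : ∀ i, l.length ≤ i → rowStart k l i + part l i = 0 := fun i hi => by
    rw [rowStart_eq_zero hi, part_eq_zero_of_length_le hi]
  set inner := ((List.range l.length).map (rowStart k l)).filter (fun x => decide (x ≠ 0))
    with hinner
  set outer := ((List.range l.length).map fun i => rowStart k l i + part l i).filter
    (fun x => decide (x ≠ 0)) with houter
  have hin : ∀ i, part inner i = rowStart k l i :=
    part_filter_map_range hanti fun i hi => rowStart_eq_zero hi
  have hout : ∀ i, part outer i = rowStart k l i + part l i := part_filter_map_range hanti' hzero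
  have hlen : outer.length = l.length := by
    rw [houter, List.filter_eq_self.2, List.length_map, List.length_range]
    intro x hx
    obtain ⟨i, hi, rfl⟩ := List.mem_map.1 hx
    have hi := List.mem_range.1 hi
    have := hl.1.2 _ (List.getElem_mem hi)
    rw [part_eq_getElem hi]
    simp only [decide_eq_true_eq]
    omega
  have hcol : ∀ i, i < l.length → ∀ j v, v < colLenFrom outer inner (i + 1) j ↔
      j < colCount k (l.drop (i + 1)) v := fun i hi =>
    lt_colLenFrom_iff hl.1 hlen (fun i _ _ => ⟨hin i, hout i⟩) hi
  refine ⟨(outer, inner), isPartition_filter_map_range hanti' _,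
    isPartition_filter_map_range hanti _, fun i => ?_, fun i => ?_, fun i j h1 h2 => ?_,
    fun i j h1 => ?_⟩
  · rw [hin, hout]
    omega
  · simp only [hin, hout]
    omega
  all_goals
    have hi : i < l.length := by
      by_contra! hi
      have := hzero i hi
      simp only [hin, hout] at *
      omega
    have hk : part l i ≤ k := by
      rw [part_eq_getElem hi]
      exact hl.le _ (List.getElem_mem hi)
    have h3 := hcol i hi j (k - part l i)
    rw [hookLen_eq]
    simp only [hin, hout] at *
    rw [← rowStart] at h3
    omega

theorem lt_part_kConj_iff {k : ℕ} {l : List ℕ} (hl : KBounded k l) (j v : ℕ) :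
    v < part (kConj k l) j ↔ j < colCount k l v := by
  have hex := exists_isKSkew hl
  have hskew := hex.choose_spec
  have hcol := hskew.lt_colLen_iff hl
  have hanti : Antitone (colLen hex.choose.1 hex.choose.2) := by
    intro a b hab
    by_contra! hlt
    have h1 := (hcol b _).1 hlt
    have h2 := (hcol a _).2 (hab.trans_lt h1)
    omega
  rw [kConj, dif_pos hex, skewCols, part_filter_map_range hanti, hcol]
  intro j hj
  rw [colLen, Finset.card_eq_zero, Finset.filter_eq_empty_iff]
  intro i hi h
  have hle : part hex.choose.1 i ≤ part hex.choose.1 0 :=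
    antitone_nat_of_succ_le (part_succ_le hskew.1) (Nat.zero_le i)
  omega

theorem subDiag_kConj_iff {k : ℕ} {l m : List ℕ} (hl : KBounded k l) (hm : KBounded k m) :
    SubDiag (kConj k l) (kConj k m) ↔ ∀ v, colCount k l v ≤ colCount k m v := by
  have key (a b v : ℕ) (h : ∀ j, j < a → j < b) : a ≤ b := by
    by_contra! hlt
    exact lt_irrefl _ (h b hlt)
  constructor
  · intro h v
    refine key _ _ v fun j hj => ?_
    exact (lt_part_kConj_iff hm j v).1 (((lt_part_kConj_iff hl j v).2 hj).trans_le (h j))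
  · intro h j
    refine key _ _ j fun v hv => ?_
    exact (lt_part_kConj_iff hm j v).2 (((lt_part_kConj_iff hl j v).1 hv).trans_le (h v))

/-! ### Unions with a `k`-rectangle -/

/-- The `k`-rectangle with parts `ℓ`. -/
abbrev kRect (k ℓ : ℕ) : List ℕ := List.replicate (k - ℓ + 1) ℓ

theorem punion_perm (l r : List ℕ) : (punion l r).Perm (l ++ r) := List.mergeSort_perm _ _

theorem IsPartition.punion {l r : List ℕ} (hl : IsPartition l) (hr : IsPartition r) :
    IsPartition (punion l r) := by
  refine ⟨?_, fun x hx => ?_⟩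
  · have := List.pairwise_mergeSort (le := fun a b : ℕ => decide (a ≥ b))
      (fun a b c hab hbc => by simp only [decide_eq_true_eq] at *; omega)
      (fun a b => by simp only [Bool.or_eq_true, decide_eq_true_eq]; omega) (l ++ r)
    exact this.imp fun h => of_decide_eq_true h
  · rcases List.mem_append.1 ((punion_perm l r).mem_iff.1 hx) with h | h
    · exact hl.2 x h
    · exact hr.2 x h

theorem isPartition_kRect {k ℓ : ℕ} (hℓ : 1 ≤ ℓ) : IsPartition (kRect k ℓ) :=
  ⟨List.pairwise_replicate.2 (Or.inr le_rfl), fun x hx => by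
    rw [List.eq_of_mem_replicate hx]; exact hℓ⟩

theorem KBounded.punion_kRect {k ℓ : ℕ} (hℓ : 1 ≤ ℓ) (hℓk : ℓ ≤ k) {l : List ℕ}
    (hl : KBounded k l) : KBounded k (punion l (kRect k ℓ)) := by
  refine kBounded_iff.2 ⟨hl.1.punion (isPartition_kRect hℓ), fun x hx => ?_⟩
  rcases List.mem_append.1 ((punion_perm _ _).mem_iff.1 hx) with h | h
  · exact hl.le x h
  · rw [List.eq_of_mem_replicate h]
    exact hℓk

theorem subDiag_punion_iff {l m r : List ℕ} (hl : IsPartition l) (hm : IsPartition m)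
    (hr : IsPartition r) : SubDiag (punion l r) (punion m r) ↔ SubDiag l m := by
  rw [subDiag_iff_countP (hl.punion hr) (hm.punion hr), subDiag_iff_countP hl hm]
  simp [(punion_perm _ _).countP_eq]

theorem IsPartition.eq_of_punion_eq {l m r : List ℕ} (hl : IsPartition l) (hm : IsPartition m)
    (h : _root_.punion l r = _root_.punion m r) : l = m :=
  hl.eq_of_perm hm <| (List.perm_append_right_iff r).1 <|
    (punion_perm l r).symm.trans (h ▸ punion_perm m r)

theorem filter_append_filter_perm (l : List ℕ) (ℓ : ℕ) :
    (l.filter (fun x => decide (ℓ ≤ x)) ++ l.filter (fun x => decide (x < ℓ))).Perm l := by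
  have h := List.filter_append_perm (fun x => decide (ℓ ≤ x)) l
  simp only [← decide_not, not_le] at h
  exact h

theorem punion_kRect_eq {k ℓ : ℕ} (hℓ : 1 ≤ ℓ) {l : List ℕ} (hl : IsPartition l) :
    punion l (kRect k ℓ) = l.filter (fun x => decide (ℓ ≤ x)) ++
      (kRect k ℓ ++ l.filter (fun x => decide (x < ℓ))) := by
  refine (hl.punion (isPartition_kRect hℓ)).eq_of_perm ⟨?_, fun x hx => ?_⟩ ?_
  · refine List.pairwise_append.2 ⟨hl.1.filter _, List.pairwise_append.2
      ⟨(isPartition_kRect hℓ).1, hl.1.filter _, ?_⟩, ?_⟩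
    all_goals
      intro a ha b hb
      simp only [List.mem_append, List.mem_filter, List.mem_replicate, decide_eq_true_eq] at ha hb
      omega
  · simp only [List.mem_append, List.mem_filter, List.mem_replicate] at hx
    rcases hx with h | h | h
    · exact hl.2 x h.1
    · omega
    · exact hl.2 x h.1
  · refine (punion_perm _ _).trans ?_
    refine List.Perm.trans ?_ ((List.perm_append_comm).append_left _)
    rw [← List.append_assoc]
    refine List.Perm.append_right _ ?_
    exact (filter_append_filter_perm l ℓ).symm

theorem filter_append_filter {l : List ℕ} (hl : IsPartition l) (ℓ : ℕ) :
    l.filter (fun x => decide (ℓ ≤ x)) ++ l.filter (fun x => decide (x < ℓ)) = l := by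
  have hperm := filter_append_filter_perm l ℓ
  refine IsPartition.eq_of_perm ⟨List.pairwise_append.2 ⟨hl.1.filter _, hl.1.filter _, ?_⟩,
    fun x hx => hl.2 x (hperm.mem_iff.1 hx)⟩ hl hperm
  intro a ha b hb
  simp only [List.mem_filter, decide_eq_true_eq] at ha hb
  omega

/-- Taking the union with a `k`-rectangle adds the conjugate rectangle to the `k`-conjugate. -/
theorem colCount_punion_kRect {k ℓ : ℕ} (hℓ : 1 ≤ ℓ) {l : List ℕ} (hl : IsPartition l) (v : ℕ) :
    colCount k (punion l (kRect k ℓ)) v = colCount k l v + if v ≤ k - ℓ then ℓ else 0 := by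
  rw [punion_kRect_eq hℓ hl, colCount_append]
  conv_rhs => rw [← filter_append_filter hl ℓ, colCount_append]
  refine foldr_rowStep_add (fun v => ?_) (fun x hx => by simpa using (List.mem_filter.1 hx).2) v
  rw [colCount_replicate_append, rowStep_iterate _ le_rfl]
  split_ifs
  · simp
  · omega
  · simp

theorem kCover_punion_iff {k ℓ : ℕ} (hℓ : 1 ≤ ℓ) (hℓk : ℓ ≤ k) {l m : List ℕ}
    (hl : KBounded k l) (hm : KBounded k m) :
    KCover k (punion l (kRect k ℓ)) (punion m (kRect k ℓ)) ↔ KCover k l m := by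
  have hl' := hl.punion_kRect hℓ hℓk
  have hm' := hm.punion_kRect hℓ hℓk
  have hsum : (punion m (kRect k ℓ)).sum = (punion l (kRect k ℓ)).sum + 1 ↔
      m.sum = l.sum + 1 := by
    rw [(punion_perm m _).sum_eq, (punion_perm l _).sum_eq, List.sum_append, List.sum_append]
    omega
  simp only [KCover, hl, hm, hl', hm', true_and, hsum,
    subDiag_punion_iff hl.1 hm.1 (isPartition_kRect hℓ), subDiag_kConj_iff,
    colCount_punion_kRect hℓ hl.1, colCount_punion_kRect hℓ hm.1, add_le_add_iff_right]

theorem exists_eq_punion_kRect {k ℓ : ℕ} (hℓ : 1 ≤ ℓ) {n : List ℕ} (hn : KBounded k n)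
    (hc : k - ℓ + 1 ≤ n.count ℓ) : ∃ m, KBounded k m ∧ n = punion m (kRect k ℓ) := by
  have hsub : (kRect k ℓ).Sublist n := List.replicate_sublist_iff.2 hc
  have hm : KBounded k (n.diff (kRect k ℓ)) :=
    kBounded_iff.2 ⟨hn.1.sublist (List.diff_sublist _ _),
      fun x hx => hn.le x ((List.diff_sublist _ _).subset hx)⟩
  refine ⟨_, hm, hn.1.eq_of_perm (hm.1.punion (isPartition_kRect hℓ)) ?_⟩
  exact (List.subperm_append_diff_self_of_count_le (List.subperm_ext_iff.1 hsub.subperm)).symm.trans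
    (List.perm_append_comm.trans (punion_perm _ _).symm)

/-- Enlarging the only `k`-rectangle of parts `ℓ` strictly decreases the number of long columns. -/
theorem colCount_lt_of_replace {k ℓ : ℕ} (hℓ : 1 ≤ ℓ) (hℓk : ℓ < k) {a b : List ℕ}
    (ha : ∀ x ∈ a, ℓ < x) (hb : b.Pairwise (· ≥ ·)) (hbℓ : ∀ x ∈ b, x < ℓ) :
    colCount k (a ++ (ℓ + 1) :: (List.replicate (k - ℓ) ℓ ++ b)) (k - ℓ) <
      colCount k (a ++ ℓ :: (List.replicate (k - ℓ) ℓ ++ b)) (k - ℓ) := by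
  have ha' : ∀ x ∈ a, k - x < k - ℓ := fun x hx => by
    have := ha x hx
    omega
  rw [colCount_append, colCount_append, foldr_rowStep_of_lt _ (by omega) ha',
    foldr_rowStep_of_lt _ (by omega) ha', ← List.cons_append (a := ℓ), ← List.replicate_succ,
    colCount_replicate_append, rowStep_iterate (colCount k b) (t := k - ℓ + 1) le_rfl, colCount,
    colCount_replicate_append, rowStep, if_neg (by omega), if_neg (by omega),
    rowStep_iterate (colCount k b) (t := k - ℓ) (by omega), if_pos le_rfl,
    if_neg (lt_irrefl _), if_pos le_rfl, if_pos (Nat.lt_succ_self _), Nat.sub_self,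
    Nat.add_sub_cancel]
  have h1 := colCount_zero_le (k := k) hb (s := ℓ - 1) fun x hx => by
    have := hbℓ x hx
    omega
  have h2 := antitone_colCount (k := k) hb (show k - ℓ ≤ k - (ℓ - 1) by omega)
  omega

theorem exists_eq_punion_of_kCover {k ℓ : ℕ} (hℓ : 1 ≤ ℓ) {l n : List ℕ}
    (h : KCover k (punion l (kRect k ℓ)) n) :
    ∃ m, KBounded k m ∧ n = punion m (kRect k ℓ) := by
  obtain ⟨hu, hn, hsub, hconj, hsum⟩ := h
  by_cases hc : k - ℓ + 1 ≤ n.count ℓ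
  · exact exists_eq_punion_kRect hℓ hn hc
  exfalso
  have hcu : (punion l (kRect k ℓ)).count ℓ = l.count ℓ + (k - ℓ + 1) := by
    rw [(punion_perm _ _).count_eq, List.count_append, List.count_replicate_self]
  rcases SubDiag.add_one_cases hsub hu.1.2 hn.1.2 hsum with rfl | ⟨a, r, b, hab, rfl⟩
  · rw [List.count_append] at hc
    omega
  rw [hab, List.count_append, List.count_cons] at hcu
  rw [List.count_append, List.count_cons] at hc
  obtain rfl : r = ℓ := by
    by_contra hr
    simp only [beq_iff_eq, hr, if_false] at hcu
    split_ifs at hc <;> omega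
  simp only [beq_iff_eq, Nat.succ_ne_self, if_true, if_false] at hc hcu
  have hrk : r < k := hn.le (r + 1) (by simp)
  have hn1 := List.pairwise_append.1 hn.1.1
  have ha : ∀ x ∈ a, r < x := fun x hx => hn1.2.2 x hx (r + 1) (by simp)
  have hu1 := hu.1
  rw [hab] at hu1
  have hb : IsPartition (r :: b) := hu1.sublist (List.sublist_append_right _ _)
  have hle := (List.pairwise_cons.1 hb.1).1
  have ha0 : a.count r = 0 := List.count_eq_zero.2 fun hr => lt_irrefl r (ha r hr)
  have hcb : b.count r = k - r := by omega
  have hbeq : b = List.replicate (k - r) r ++ b.filter (fun x => decide (x < r)) := by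
    have h1 : b.filter (fun x => decide (r ≤ x)) = List.replicate (k - r) r := by
      rw [← hcb, ← List.filter_eq]
      refine List.filter_congr fun x hx => ?_
      have := hle x hx
      simp only [decide_eq_decide]
      omega
    rw [← h1, filter_append_filter hb.tail]
  have hlt := colCount_lt_of_replace hℓ hrk ha (hb.tail.1.filter (fun x => decide (x < r)))
    (fun x hx => of_decide_eq_true (List.mem_filter.1 hx).2)
  rw [← hbeq, ← hab] at hlt
  exact hlt.not_ge ((subDiag_kConj_iff hu hn).1 hconj (k - r))

theorem exists_kLe_of_kLe_punion {k ℓ : ℕ} (hℓ : 1 ≤ ℓ) (hℓk : ℓ ≤ k) {l n : List ℕ}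
    (hl : KBounded k l) (h : KLe k (punion l (kRect k ℓ)) n) :
    ∃ m, KBounded k m ∧ n = punion m (kRect k ℓ) ∧ KLe k l m := by
  induction h with
  | refl => exact ⟨l, hl, rfl, Relation.ReflTransGen.refl⟩
  | tail _ hcov ih =>
    obtain ⟨m, hm, rfl, hlm⟩ := ih
    obtain ⟨m', hm', rfl⟩ := exists_eq_punion_of_kCover hℓ hcov
    exact ⟨m', hm', rfl, hlm.tail ((kCover_punion_iff hℓ hℓk hm hm').1 hcov)⟩

/-- for any `k`-rectangle `□` and `k`-bounded partitions `λ, μ`: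
`λ ≼ μ` iff `(λ ∪ □) ≼ (μ ∪ □)` in the `k`-Young order. -/
theorem kLe_iff_union_kRectangle (k ℓ : ℕ) (hℓ : 1 ≤ ℓ) (hℓk : ℓ ≤ k) (lam μ : List ℕ)
    (hlam : KBounded k lam) (hμ : KBounded k μ) :
    KLe k lam μ ↔
      KLe k (punion lam (List.replicate (k - ℓ + 1) ℓ))
        (punion μ (List.replicate (k - ℓ + 1) ℓ)) := by
  constructor
  · exact fun h => h.lift _ fun _ _ hcov =>
      (kCover_punion_iff hℓ hℓk hcov.1 hcov.2.1).2 hcov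
  · intro h
    obtain ⟨m, hm, heq, hle⟩ := exists_kLe_of_kLe_punion hℓ hℓk hlam h
    rwa [hμ.1.eq_of_punion_eq hm.1 heq]
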